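/- If κ is a huge cardinal, then there exists λ > κ and an ℵ₀-guessing model M ≺ V_λ with κ_M = κ and otp(M ∩ λ) ≥ κ. -/

import Mathlib

open Cardinal

namespace GuessingModels

/-- First-order formulas in the language of set theory (membership and equality),
with `n` free variables. -/
inductive SF : ℕ → Type
  | mem {n} (i j : Fin n) : SF n
  | eq {n} (i j : Fin n) : SF n
  | imp {n} (f g : SF n) : SF n
  | not {n} (f : SF n) : SF n
  | ex {n} (f : SF (n + 1)) : SF n

/-- Tarskian satisfaction of a set-theoretic formula in the structure `⟨S, ∈⟩`,
where `S` is a class of ZF sets. -/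
def Realize (S : Set ZFSet) : ∀ {n}, SF n → (Fin n → ZFSet) → Prop
  | _, .mem i j, v => v i ∈ v j
  | _, .eq i j, v => v i = v j
  | _, .imp f g, v => Realize S f v → Realize S g v
  | _, .not f, v => ¬ Realize S f v
  | _, .ex f, v => ∃ x ∈ S, Realize S f (Fin.cons x v)

/-- `M ≺ R` : `M` is an elementary substructure of `⟨R, ∈⟩`. -/
def Prec (M R : Set ZFSet) : Prop :=
  M ⊆ R ∧ ∀ {n : ℕ} (φ : SF n) (v : Fin n → ZFSet), (∀ i, v i ∈ M) →
    (Realize M φ v ↔ Realize R φ v)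

/-- A (von Neumann) ordinal: a transitive set of transitive sets. -/
def IsOrd (x : ZFSet) : Prop :=
  x.IsTransitive ∧ ∀ y ∈ x, ZFSet.IsTransitive y

/-- `≤` on ordinals, i.e. `∈` or `=`. -/
def ole (a b : ZFSet) : Prop := a ∈ b ∨ a = b

/-- The cardinality of (the extension of) a ZF set. -/
noncomputable def card (x : ZFSet) : Cardinal := Cardinal.mk x.toSet

/-- A ZF set which is a cardinal: an ordinal not equinumerous with any of its members. -/
def IsCard (κ : ZFSet) : Prop := IsOrd κ ∧ ∀ β ∈ κ, card β < card κ

/-- `s` (an external class) is a cofinal subset of the ordinal `κ`. -/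
def CofinalSetIn (s : Set ZFSet) (κ : ZFSet) : Prop :=
  (∀ x ∈ s, x ∈ κ) ∧ ∀ β ∈ κ, ∃ γ ∈ s, ole β γ

/-- A regular cardinal: an infinite cardinal all of whose cofinal subsets have full size. -/
def IsRegCard (κ : ZFSet) : Prop :=
  IsCard κ ∧ ZFSet.omega ⊆ κ ∧
    ∀ s : Set ZFSet, CofinalSetIn s κ → Cardinal.mk s = card κ

/-- A strong limit ZF cardinal. -/
def IsStrongLimit (κ : ZFSet) : Prop := ∀ β ∈ κ, (2 : Cardinal) ^ card β < card κ

/-- A strongly inaccessible cardinal: regular, uncountable and strong limit. -/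
def IsInacc (κ : ZFSet) : Prop := IsRegCard κ ∧ ZFSet.omega ∈ κ ∧ IsStrongLimit κ

/-- The transitive closure of a ZF set, as a class. -/
def tcl (x : ZFSet) : Set ZFSet := {y | Relation.TransGen (· ∈ ·) y x}

/-- `H_θ` : the class of sets hereditarily of size `< θ`. -/
noncomputable def HSet (θ : ZFSet) : Set ZFSet := {x | Cardinal.mk (tcl x) < card θ}

/-- `V_α` as a class, for `α` an ordinal (as a ZF set): sets of rank `< α`. -/
noncomputable def VSet (α : ZFSet) : Set ZFSet := {x | x.rank < α.rank}

/-- A suitable initial segment: `H_θ` for a regular cardinal `θ`, or a rank initial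
segment `V_α`. -/
def Suitable (R : Set ZFSet) : Prop :=
  (∃ θ : ZFSet, IsRegCard θ ∧ R = HSet θ) ∨ (∃ α : ZFSet, IsOrd α ∧ R = VSet α)

/-- `κ = κ_M` : `κ` is the least ordinal in `M` with `M ∩ κ ≠ κ`. -/
def KappaSpec (M : Set ZFSet) (κ : ZFSet) : Prop :=
  IsOrd κ ∧ κ ∈ M ∧ (∃ β ∈ κ, β ∉ M) ∧
    ∀ α : ZFSet, IsOrd α → α ∈ M → (∃ β ∈ α, β ∉ M) → ole κ α

/-- `d` is `(δ, M)`-approximated: `d ∩ Z ∈ M` for every `Z ∈ M` of size `< δ`. -/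
noncomputable def Approx (M : Set ZFSet) (δ : Cardinal.{1}) (d : ZFSet) : Prop :=
  ∀ Z : ZFSet, Z ∈ M → card Z < δ → (d ∩ Z) ∈ M

/-- `d ⊆ X` is `M`-guessed: `d ∩ M = e ∩ M` for some `e ∈ M ∩ P(X)`. -/
def Guessed (M : Set ZFSet) (X d : ZFSet) : Prop :=
  ∃ e : ZFSet, e ∈ M ∧ e ⊆ X ∧ ∀ z ∈ M, (z ∈ e ↔ z ∈ d)

/-- `M` is a `δ`-guessing model: every `(δ,M)`-approximated subset of any `X ∈ M`
is `M`-guessed. -/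
noncomputable def GuessingModel (M : Set ZFSet) (δ : Cardinal.{1}) : Prop :=
  ∀ X ∈ M, ∀ d : ZFSet, d ⊆ X → Approx M δ d → Guessed M X d

/-- `M` is `ℵ₁`-internally unbounded: every countable subset of `M` is contained
in a countable element of `M`. -/
noncomputable def IntUnb (M : Set ZFSet) : Prop :=
  ∀ A : Set ZFSet, A ⊆ M → A.Countable → ∃ z ∈ M, card z ≤ ℵ₀ ∧ A ⊆ z.toSet


/-- `j : V → N` is an elementary embedding of the universe into the class `N`. -/
def ClassElemEmb (N : Set ZFSet) (j : ZFSet → ZFSet) : Prop :=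
  (∀ x, j x ∈ N) ∧ ∀ {n : ℕ} (φ : SF n) (v : Fin n → ZFSet),
    (Realize Set.univ φ v ↔ Realize N φ (fun i => j (v i)))

/-- A transitive class. -/
def ClassTransitive (N : Set ZFSet) : Prop := ∀ x ∈ N, ∀ y ∈ x, y ∈ N

/-- `κ` is a huge cardinal: there is `j : V → N` with `crit(j) = κ`, `N` transitive
and closed under `j(κ)`-sequences. -/
def IsHuge (κ : ZFSet) : Prop :=
  IsOrd κ ∧ ∃ (N : Set ZFSet) (j : ZFSet → ZFSet),
    ClassTransitive N ∧ ClassElemEmb N j ∧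
    (∀ β : ZFSet, IsOrd β → β ∈ κ → j β = β) ∧ κ ∈ j κ ∧ IsOrd (j κ) ∧
    ∀ f : ZFSet → ZFSet, (∀ x ∈ j κ, f x ∈ N) →
      ∃ F ∈ N, ∀ p : ZFSet, p ∈ F ↔ ∃ x, x ∈ j κ ∧ p = ZFSet.pair x (f x)

/-- The order type of the class of ordinals `A` is at least `γ`: there is a strictly
`∈`-increasing map from `γ` into `A`. -/
def OtpGe (A : Set ZFSet) (γ : ZFSet) : Prop :=
  ∃ f : ZFSet → ZFSet, (∀ x ∈ γ, f x ∈ A) ∧ ∀ x ∈ γ, ∀ y ∈ γ, x ∈ y → f x ∈ f y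

universe u

namespace SF

/-- Universal quantification. -/
def all {n} (f : SF (n + 1)) : SF n := .not (.ex (.not f))

/-- Conjunction. -/
def and {n} (f g : SF n) : SF n := .not (.imp f (.not g))

/-- Disjunction. -/
def or {n} (f g : SF n) : SF n := .imp (.not f) g

/-- Equivalence. -/
def iff {n} (f g : SF n) : SF n := and (.imp f g) (.imp g f)

/-- The formula `a = {x, y}`. -/
def upair {n} (a x y : Fin n) : SF n :=
  and (mem x a) (and (mem y a)
    (all (imp (mem 0 a.succ) (or (eq 0 x.succ) (eq 0 y.succ)))))

/-- The formula `p = (x, y)`. -/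
def opair {n} (p x y : Fin n) : SF n :=
  and (ex (and (mem 0 p.succ) (upair 0 x.succ x.succ)))
    (and (ex (and (mem 0 p.succ) (upair 0 x.succ y.succ)))
      (all (imp (mem 0 p.succ) (or (upair 0 x.succ x.succ) (upair 0 x.succ y.succ)))))

/-- The formula `(x, y) ∈ F`. -/
def app {n} (F x y : Fin n) : SF n :=
  ex (and (mem 0 F.succ) (opair 0 x.succ y.succ))

/-- The formula `x ⊆ y`. -/
def sub {n} (x y : Fin n) : SF n := all (imp (mem 0 x.succ) (mem 0 y.succ))

/-- The formula asserting that `x` is an ordinal. -/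
def ord {n} (x : Fin n) : SF n :=
  and (all (imp (mem 0 x.succ) (sub 0 x.succ)))
    (all (imp (mem 0 x.succ) (all (imp (mem 0 1) (sub 0 1)))))

end SF

section Realize

variable {S : Set ZFSet} {n : ℕ} {v : Fin n → ZFSet}

@[simp] theorem realize_mem {i j : Fin n} : Realize S (.mem i j) v ↔ v i ∈ v j := Iff.rfl

@[simp] theorem realize_eq {i j : Fin n} : Realize S (.eq i j) v ↔ v i = v j := Iff.rfl

@[simp] theorem realize_imp {f g : SF n} :
    Realize S (.imp f g) v ↔ (Realize S f v → Realize S g v) := Iff.rfl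

@[simp] theorem realize_not {f : SF n} : Realize S (.not f) v ↔ ¬ Realize S f v := Iff.rfl

@[simp] theorem realize_ex {f : SF (n + 1)} :
    Realize S (.ex f) v ↔ ∃ x ∈ S, Realize S f (Matrix.vecCons x v) := Iff.rfl

@[simp] theorem realize_all {f : SF (n + 1)} :
    Realize S (.all f) v ↔ ∀ x ∈ S, Realize S f (Matrix.vecCons x v) := by
  simp [SF.all]

@[simp] theorem realize_and {f g : SF n} :
    Realize S (.and f g) v ↔ Realize S f v ∧ Realize S g v := by
  simp [SF.and]

@[simp] theorem realize_or {f g : SF n} :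
    Realize S (.or f g) v ↔ Realize S f v ∨ Realize S g v := by
  simp only [SF.or, realize_imp, realize_not]; tauto

@[simp] theorem realize_iff {f g : SF n} :
    Realize S (.iff f g) v ↔ (Realize S f v ↔ Realize S g v) := by
  simp only [SF.iff, realize_imp, realize_and]; tauto

@[simp] theorem realize_sub {x y : Fin n} :
    Realize S (.sub x y) v ↔ ∀ z ∈ S, z ∈ v x → z ∈ v y := by
  simp [SF.sub]

theorem realize_upair (hS : ClassTransitive S) {a x y : Fin n} (ha : v a ∈ S) :
    Realize S (.upair a x y) v ↔ v a = {v x, v y} := by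
  simp only [SF.upair, realize_and, realize_mem, realize_all, realize_imp, realize_or, realize_eq,
    Matrix.cons_val_zero, Matrix.cons_val_succ]
  constructor
  · rintro ⟨hx, hy, h⟩
    ext z
    rw [ZFSet.mem_pair]
    refine ⟨fun hz => h z (hS _ ha _ hz) hz, ?_⟩
    rintro (rfl | rfl) <;> assumption
  · intro h
    simp [h]

theorem realize_opair (hS : ClassTransitive S) {p x y : Fin n} (hp : v p ∈ S) :
    Realize S (.opair p x y) v ↔ v p = ZFSet.pair (v x) (v y) := by
  have key : ∀ a ∈ S, ∀ y : Fin n,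
      Realize S (.upair 0 x.succ y.succ) (Matrix.vecCons a v) ↔ a = {v x, v y} :=
    fun a ha y => realize_upair hS (v := Matrix.vecCons a v) (a := 0) ha
  simp only [SF.opair, realize_and, realize_mem, realize_all, realize_imp, realize_or, realize_ex,
    Matrix.cons_val_zero, Matrix.cons_val_succ, ZFSet.pair]
  constructor
  · rintro ⟨⟨a, ha, hap, h₁⟩, ⟨b, hb, hbp, h₂⟩, h⟩
    rw [key _ ha] at h₁
    rw [key _ hb] at h₂
    ext z
    rw [ZFSet.mem_pair]
    constructor
    · intro hz
      have hzS := hS _ hp _ hz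
      have := h z hzS hz
      rwa [key _ hzS, key _ hzS, ZFSet.pair_eq_singleton] at this
    · rintro (rfl | rfl)
      · rwa [h₁, ZFSet.pair_eq_singleton] at hap
      · rwa [h₂] at hbp
  · intro h
    have h₁ : ({v x, v x} : ZFSet) ∈ v p := by simp [h]
    have h₂ : ({v x, v y} : ZFSet) ∈ v p := by simp [h]
    refine ⟨⟨_, hS _ hp _ h₁, h₁, (key _ (hS _ hp _ h₁) _).2 rfl⟩,
      ⟨_, hS _ hp _ h₂, h₂, (key _ (hS _ hp _ h₂) _).2 rfl⟩, fun z hzS hz => ?_⟩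
    rw [key _ hzS, key _ hzS, ZFSet.pair_eq_singleton]
    rwa [h, ZFSet.mem_pair] at hz

theorem realize_app (hS : ClassTransitive S) {F x y : Fin n} (hF : v F ∈ S) :
    Realize S (.app F x y) v ↔ ZFSet.pair (v x) (v y) ∈ v F := by
  have key : ∀ p ∈ S, Realize S (.opair 0 x.succ y.succ) (Matrix.vecCons p v) ↔
      p = ZFSet.pair (v x) (v y) :=
    fun p hp => realize_opair hS (v := Matrix.vecCons p v) (p := 0) hp
  simp only [SF.app, realize_and, realize_mem, realize_ex, Matrix.cons_val_zero,
    Matrix.cons_val_succ]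
  constructor
  · rintro ⟨p, hp, hpF, h⟩
    rw [key _ hp] at h
    rwa [← h]
  · exact fun h => ⟨_, hS _ hF _ h, h, (key _ (hS _ hF _ h)).2 rfl⟩

theorem realize_ord (hS : ClassTransitive S) {x : Fin n} (hx : v x ∈ S) :
    Realize S (.ord x) v ↔ IsOrd (v x) := by
  simp only [SF.ord, realize_and, realize_mem, realize_all, realize_imp, realize_sub,
    Matrix.cons_val_zero, Matrix.cons_val_one, Matrix.cons_val_succ]
  constructor
  · rintro ⟨h₁, h₂⟩
    refine ⟨fun y hy z hz => ?_, fun y hy z hz w hw => ?_⟩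
    · have hyS := hS _ hx _ hy
      exact h₁ y hyS hy z (hS _ hyS _ hz) hz
    · have hyS := hS _ hx _ hy
      have hzS := hS _ hyS _ hz
      exact h₂ y hyS hy z hzS hz w (hS _ hzS _ hw) hw
  · rintro ⟨h₁, h₂⟩
    exact ⟨fun y _ hy z _ hz => h₁ y hy hz, fun y _ hy z _ hz w _ hw => h₂ y hy z hz hw⟩

end Realize

theorem IsOrd.isOrdinal {x : ZFSet} (h : IsOrd x) : x.IsOrdinal :=
  ZFSet.isOrdinal_iff_forall_mem_isTransitive.2 h

theorem isOrd_iff {x : ZFSet} : IsOrd x ↔ x.IsOrdinal :=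
  ZFSet.isOrdinal_iff_forall_mem_isTransitive.symm

theorem ClassTransitive.fst_mem {S : Set ZFSet} (hS : ClassTransitive S) {F x y : ZFSet}
    (hF : F ∈ S) (h : ZFSet.pair x y ∈ F) : x ∈ S :=
  hS {x, y} (hS _ (hS _ hF _ h) _ (by simp [ZFSet.pair])) _ (by simp)

theorem ClassTransitive.snd_mem {S : Set ZFSet} (hS : ClassTransitive S) {F x y : ZFSet}
    (hF : F ∈ S) (h : ZFSet.pair x y ∈ F) : y ∈ S :=
  hS {x, y} (hS _ (hS _ hF _ h) _ (by simp [ZFSet.pair])) _ (by simp)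

theorem classTransitive_univ : ClassTransitive Set.univ := fun _ _ _ _ => trivial

/-- The image of a set under an arbitrary class function. -/
noncomputable def imageSet (f : ZFSet.{u} → ZFSet.{u}) (a : ZFSet.{u}) : ZFSet.{u} :=
  ZFSet.range fun x : a => f x

@[simp] theorem mem_imageSet {f : ZFSet.{u} → ZFSet.{u}} {a y : ZFSet.{u}} :
    y ∈ imageSet f a ↔ ∃ x ∈ a, f x = y := by
  simp [imageSet]

/-- The restriction of a class function to a set, as a set of ordered pairs. -/
noncomputable def graph (f : ZFSet.{u} → ZFSet.{u}) (a : ZFSet.{u}) : ZFSet.{u} :=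
  imageSet (fun x => ZFSet.pair x (f x)) a

@[simp] theorem pair_mem_graph {f : ZFSet.{u} → ZFSet.{u}} {a x y : ZFSet.{u}} :
    ZFSet.pair x y ∈ graph f a ↔ x ∈ a ∧ f x = y := by
  simp only [graph, mem_imageSet, ZFSet.pair_inj]
  constructor
  · rintro ⟨x, hx, rfl, rfl⟩
    exact ⟨hx, rfl⟩
  · rintro ⟨hx, rfl⟩
    exact ⟨x, hx, rfl, rfl⟩

/-- A class function maps the set `a` onto (a superset of) `b`. -/
def Covers (a b : ZFSet) : Prop := ∃ f : ZFSet → ZFSet, ∀ y ∈ b, ∃ x ∈ a, f x = y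

theorem Covers.of_le {a b : ZFSet} (h : #a ≤ #b) : Covers b a := by
  obtain ⟨e⟩ := h
  by_cases ha : ∃ z, z ∈ a
  · obtain ⟨z, hz⟩ := ha
    have : Nonempty a := ⟨⟨z, hz⟩⟩
    classical
    refine ⟨fun x => if hx : x ∈ b then (Function.invFun e ⟨x, hx⟩ : a) else ∅,
      fun y hy => ⟨e ⟨y, hy⟩, (e ⟨y, hy⟩).2, ?_⟩⟩
    beta_reduce
    rw [dif_pos (show (e ⟨y, hy⟩ : ZFSet) ∈ b from (e ⟨y, hy⟩).2)]
    simp [Function.leftInverse_invFun e.injective _]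
  · exact ⟨id, fun y hy => (ha ⟨y, hy⟩).elim⟩

/-- `j : V → N` is an elementary embedding witnessing that `κ` is huge. -/
structure HugeEmbedding (κ : ZFSet.{u}) (N : Set ZFSet.{u}) (j : ZFSet.{u} → ZFSet.{u}) :
    Prop where
  ord : IsOrd κ
  trans : ClassTransitive N
  elem : ClassElemEmb N j
  fix : ∀ β : ZFSet, IsOrd β → β ∈ κ → j β = β
  mem : κ ∈ j κ
  ord_map : IsOrd (j κ)
  closed : ∀ f : ZFSet → ZFSet, (∀ x ∈ j κ, f x ∈ N) →
    ∃ F ∈ N, ∀ p : ZFSet, p ∈ F ↔ ∃ x, x ∈ j κ ∧ p = ZFSet.pair x (f x)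

namespace HugeEmbedding

open ZFSet
open scoped Ordinal

variable {κ : ZFSet.{u}} {N : Set ZFSet.{u}} {j : ZFSet.{u} → ZFSet.{u}}

section Transfer

variable (H : HugeEmbedding κ N j)
include H

theorem map_mem (x : ZFSet) : j x ∈ N := H.elem.1 x

theorem transfer {n : ℕ} (φ : SF n) (v : Fin n → ZFSet) :
    Realize Set.univ φ v ↔ Realize N φ (j ∘ v) := H.elem.2 φ v

theorem mem_iff {x y : ZFSet} : j x ∈ j y ↔ x ∈ y := by
  simpa using (H.transfer (.mem 0 1) ![x, y]).symm

theorem map_sub {x y : ZFSet} (h : x ⊆ y) : j x ⊆ j y := by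
  have := (H.transfer (.sub 0 1) ![x, y]).1 (by simpa using fun z hz => h hz)
  simp only [realize_sub] at this
  exact fun z hz => this z (H.trans _ (H.map_mem x) _ hz) hz

theorem ord_iff {x : ZFSet} : IsOrd (j x) ↔ IsOrd x := by
  have := H.transfer (.ord 0) ![x]
  rw [realize_ord classTransitive_univ trivial, realize_ord H.trans (H.map_mem x)] at this
  exact this.symm

theorem map_pair (x y : ZFSet) : j (pair x y) = pair (j x) (j y) := by
  have := H.transfer (.opair 0 1 2) ![pair x y, x, y]
  rw [realize_opair classTransitive_univ trivial, realize_opair H.trans (H.map_mem _)] at this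
  exact this.1 rfl

theorem map_graph_unique (f : ZFSet → ZFSet) (a : ZFSet) {x y z : ZFSet}
    (hy : pair x y ∈ j (graph f a)) (hz : pair x z ∈ j (graph f a)) : y = z := by
  have := (H.transfer (.all (.all (.all (.imp (.app 3 0 1) (.imp (.app 3 0 2) (.eq 1 2))))))
    ![graph f a]).1 (by
      simp only [realize_all, realize_imp, realize_eq]
      intro z _ y _ x _
      rw [realize_app classTransitive_univ trivial, realize_app classTransitive_univ trivial]
      simp +contextual)
  simp only [realize_all, realize_imp, realize_eq] at this
  have hG := H.map_mem (graph f a)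
  have := this z (H.trans.snd_mem hG hz) y (H.trans.snd_mem hG hy) x (H.trans.fst_mem hG hy)
  rw [realize_app H.trans (by exact hG), realize_app H.trans (by exact hG)] at this
  exact this hy hz

theorem eq_of_pair_mem_map_graph {f : ZFSet → ZFSet} {a x z : ZFSet} (hx : x ∈ a)
    (hz : pair (j x) z ∈ j (graph f a)) : z = j (f x) := by
  refine H.map_graph_unique f a hz ?_
  rw [← H.map_pair, H.mem_iff]
  simp [hx]

/-- If `f` maps `a` onto `b` then `j f` maps `j a` onto `j b` in the sense of `N`. -/
theorem map_graph_surj {f : ZFSet → ZFSet} {a b : ZFSet} (hf : ∀ y ∈ b, ∃ x ∈ a, f x = y)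
    {y : ZFSet} (hy : y ∈ j b) : ∃ x ∈ j a, pair x y ∈ j (graph f a) := by
  have := (H.transfer (.all (.imp (.mem 0 1) (.ex (.and (.mem 0 3) (.app 4 0 1)))))
    ![b, a, graph f a]).1 (by
      simp only [realize_all, realize_imp, realize_ex, realize_and]
      intro y _ hy
      obtain ⟨x, hx, h⟩ := hf y hy
      refine ⟨x, trivial, hx, ?_⟩
      rw [realize_app classTransitive_univ trivial]
      simp [hx, h])
  simp only [realize_all, realize_imp, realize_ex, realize_and] at this
  obtain ⟨x, hxN, hx, h⟩ := this y (H.trans _ (H.map_mem b) _ hy) hy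
  rw [realize_app H.trans (by exact H.map_mem (graph f a))] at h
  exact ⟨x, hx, h⟩

theorem exists_range {F : ZFSet} (hF : F ∈ N) :
    ∃ R ∈ N, ∀ y ∈ N, y ∈ R ↔ ∃ x ∈ N, pair x y ∈ F := by
  have := (H.transfer (.all (.ex (.all (.iff (.mem 0 1) (.ex (.app 3 0 1)))))) ![]).1 (by
      simp only [realize_all, realize_iff, realize_ex]
      intro F _
      refine ⟨(⋃₀ (⋃₀ F : ZFSet) : ZFSet).sep fun y => ∃ x, pair x y ∈ F, trivial,
        fun y _ => ?_⟩
      have : (∃ x ∈ Set.univ, Realize Set.univ (.app 3 0 1)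
          ![x, y, (⋃₀ (⋃₀ F : ZFSet) : ZFSet).sep fun y => ∃ x, pair x y ∈ F, F]) ↔
          ∃ x, pair x y ∈ F := by
        simp only [Set.mem_univ, true_and]
        exact exists_congr fun x => realize_app classTransitive_univ trivial
      refine Iff.trans ?_ this.symm
      simp only [realize_mem, Matrix.cons_val_zero, Matrix.cons_val_one, mem_sep, mem_sUnion]
      refine ⟨And.right, fun ⟨x, hx⟩ => ⟨⟨{x, y}, ⟨_, hx, by simp [pair]⟩, by simp⟩, x, hx⟩⟩)
  simp only [realize_all, realize_iff, realize_ex] at this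
  obtain ⟨R, hR, h⟩ := this F hF
  refine ⟨R, hR, fun y hy => (h y hy).trans (exists_congr fun x => and_congr_right fun _ => ?_)⟩
  exact realize_app H.trans hF

theorem exists_mem_of_mem {β : ZFSet} (hβ : β ∈ κ) : ∃ γ ∈ κ, β ∈ γ := by
  by_contra! hcon
  have hκ := H.ord.isOrdinal
  have := (H.transfer (.all (.imp (.mem 0 1) (.or (.mem 0 2) (.eq 0 2)))) ![κ, β]).1 (by
    simp only [realize_all, realize_imp, realize_or, realize_mem, realize_eq]
    intro x _ hx
    rcases (hκ.mem hx).mem_trichotomous (hκ.mem hβ) with h | h | h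
    · exact .inl h
    · exact .inr h
    · exact (hcon x hx h).elim)
  simp only [realize_all, realize_imp, realize_or, realize_mem, realize_eq] at this
  have hj : j β = β := H.fix β (isOrd_iff.2 (hκ.mem hβ)) hβ
  have : κ ∈ j β ∨ κ = j β := this κ (H.trans _ (H.map_mem κ) _ H.mem) H.mem
  rw [hj] at this
  rcases this with h | h
  · exact mem_asymm h hβ
  · exact mem_irrefl β (h ▸ hβ)

theorem exists_mem_of_mem_map {β : ZFSet} (hβ : β ∈ j κ) : ∃ γ ∈ j κ, β ∈ γ := by
  have := (H.transfer (.all (.imp (.mem 0 1) (.ex (.and (.mem 0 2) (.mem 1 0))))) ![κ]).1 (by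
    simp only [realize_all, realize_imp, realize_ex, realize_and]
    intro x _ hx
    obtain ⟨γ, hγ, h⟩ := H.exists_mem_of_mem hx
    exact ⟨γ, trivial, hγ, h⟩)
  simp only [realize_all, realize_imp, realize_ex, realize_and] at this
  obtain ⟨γ, _, h₁, h₂⟩ := this β (H.trans _ (H.map_mem κ) _ hβ) hβ
  exact ⟨γ, h₁, h₂⟩

theorem nonempty : κ.Nonempty := by
  by_contra hcon
  have := (H.transfer (.all (.not (.mem 0 1))) ![κ]).1 (by
    simp only [realize_all, realize_not]
    intro x _ hx
    exact hcon ⟨x, hx⟩)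
  simp only [realize_all, realize_not] at this
  exact this κ (H.trans _ (H.map_mem κ) _ H.mem) H.mem

end Transfer

/-- The formula saying that every member of `C` is the set of all subsets of
those members of `C` that belong to it. -/
def levelFormula : SF 1 :=
  .all (.imp (.mem 0 1) (.all (.iff (.mem 0 1)
    (.ex (.and (.mem 0 3) (.and (.mem 0 2) (.sub 1 0)))))))

theorem mem_iff_rank_lt {S : Set ZFSet} (hS : ClassTransitive S) {C : ZFSet} (hC : C ∈ S)
    (h : Realize S levelFormula ![C]) (w : ZFSet) (hw : w ∈ C) {x : ZFSet} (hx : x ∈ S) :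
    x ∈ w ↔ rank x < rank w := by
  induction w using ZFSet.inductionOn generalizing x with
  | _ w ih =>
  refine ⟨rank_lt_of_mem, fun hr => ?_⟩
  have hwS := hS _ hC _ hw
  simp only [levelFormula, realize_all, realize_imp, realize_iff, realize_ex, realize_and,
    realize_sub] at h
  have h : ∀ x ∈ S, x ∈ w ↔ ∃ u ∈ S, u ∈ C ∧ u ∈ w ∧ ∀ z ∈ S, z ∈ x → z ∈ u := h w hwS hw
  obtain ⟨y, hy, hxy⟩ := lt_rank_iff.1 hr
  have hyS := hS _ hwS _ hy
  obtain ⟨u, huS, huC, huw, hyu⟩ := (h y hyS).1 hy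
  have hyu : rank y ≤ rank u := rank_mono fun z hz => hyu z (hS _ hyS _ hz) hz
  refine (h x hx).2 ⟨u, huS, huC, huw, fun z hzS hz => (ih u huw huC hzS).2 ?_⟩
  exact (rank_lt_of_mem hz).trans_le (hxy.trans hyu)

theorem realize_levelFormula (o : Ordinal.{u}) :
    Realize Set.univ levelFormula ![imageSet (fun x => V_ (rank x)) (Order.succ o).toZFSet] := by
  have key : ∀ w : ZFSet, w ∈ imageSet (fun x => V_ (rank x)) (Order.succ o).toZFSet ↔
      ∃ a ≤ o, V_ a = w := by
    intro w
    simp only [Order.succ_eq_add_one, Ordinal.toZFSet_add_one, mem_imageSet, mem_insert_iff,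
      Ordinal.mem_toZFSet_iff, exists_eq_or_imp, Ordinal.rank_toZFSet, ↓existsAndEq, and_true]
    simp [le_iff_eq_or_lt, or_and_right, exists_or]
  generalize imageSet (fun x => V_ (rank x)) (Order.succ o).toZFSet = C at key
  simp only [levelFormula, realize_all, realize_imp, realize_iff, realize_ex, realize_and,
    realize_sub]
  intro w _ hw x _
  obtain ⟨a, ha, rfl⟩ := (key w).1 hw
  change x ∈ V_ a ↔ ∃ u ∈ Set.univ, u ∈ C ∧ u ∈ V_ a ∧ ∀ z ∈ Set.univ, z ∈ x → z ∈ u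
  rw [mem_vonNeumann]
  constructor
  · intro hx
    exact ⟨V_ (rank x), trivial, (key _).2 ⟨_, hx.le.trans ha, rfl⟩,
      vonNeumann_mem_of_lt hx, fun z _ hz => subset_vonNeumann_self x hz⟩
  · rintro ⟨u, -, hu, hua, hxu⟩
    exact (rank_mono fun z hz => hxu z trivial hz).trans_lt (mem_vonNeumann.1 hua)

section Rank

variable (H : HugeEmbedding κ N j)
include H

/-- `j` sends `V_b` to `V_{j(b)}` in the sense of `N`. -/
theorem mem_map_vonNeumann {b : ZFSet} (hb : IsOrd b) {x : ZFSet} :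
    x ∈ j (V_ (rank b)) ↔ x ∈ N ∧ rank x < rank (j b) := by
  set v := V_ (rank b) with hv
  set C := imageSet (fun x => V_ (rank x)) (Order.succ (rank b)).toZFSet with hC
  have hlev := (H.transfer levelFormula ![C]).1 (realize_levelFormula _)
  have hlev : Realize N levelFormula ![j C] := by
    convert hlev using 1
    funext i
    fin_cases i
    rfl
  have hvC : j v ∈ j C := by
    rw [H.mem_iff, hC, mem_imageSet]
    exact ⟨b, by rw [← hb.isOrdinal.toZFSet_rank_eq]; simp, rfl⟩
  have key : ∀ {x}, x ∈ N → (x ∈ j v ↔ rank x < rank (j v)) :=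
    fun hx => mem_iff_rank_lt H.trans (H.map_mem C) hlev _ hvC hx
  have hord := (H.transfer (.all (.imp (.ord 0) (.iff (.mem 0 1) (.mem 0 2)))) ![v, b]).1 (by
    simp only [realize_all, realize_imp, realize_iff]
    intro x _ hx
    rw [realize_ord classTransitive_univ trivial] at hx
    change x ∈ v ↔ x ∈ b
    rw [hv, mem_vonNeumann]
    exact hx.isOrdinal.rank_lt_iff_mem hb.isOrdinal)
  simp only [realize_all, realize_imp, realize_iff] at hord
  have hord : ∀ x ∈ N, IsOrd x → (x ∈ j v ↔ x ∈ j b) := fun x hx hx' =>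
    hord x hx ((realize_ord H.trans (by exact hx)).2 hx')
  have hjb := H.ord_iff.2 hb
  have hrank : rank (j v) = rank (j b) := by
    refine le_antisymm (not_lt.1 fun hlt => ?_) (rank_le_iff.2 fun y hy => ?_)
    · exact mem_irrefl _ ((hord _ (H.map_mem b) hjb).1 ((key (H.map_mem b)).2 hlt))
    · have hyN := H.trans _ (H.map_mem b) _ hy
      exact rank_lt_of_mem ((hord y hyN (isOrd_iff.2 (hjb.isOrdinal.mem hy))).2 hy)
  rw [← hrank]
  exact ⟨fun hx => ⟨H.trans _ (H.map_mem v) _ hx, rank_lt_of_mem hx⟩, fun hx => (key hx.1).2 hx.2⟩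

theorem toZFSet_mem {o : Ordinal} (ho : o < rank κ) : o.toZFSet ∈ κ := by
  rw [← H.ord.isOrdinal.toZFSet_rank_eq]
  simpa using ho

theorem map_eq_of_rank_lt (x : ZFSet) (hx : rank x < rank κ) : j x = x := by
  induction hr : rank x using WellFoundedLT.induction generalizing x with
  | _ o ih =>
  subst hr
  have hb := H.toZFSet_mem hx
  have hbo : IsOrd (rank x).toZFSet := isOrd_iff.2 (isOrdinal_toZFSet _)
  have hsub : x ⊆ V_ (rank (rank x).toZFSet) := by
    rw [Ordinal.rank_toZFSet]; exact subset_vonNeumann_self x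
  have ih' : ∀ y, rank y < rank x → j y = y := fun y hy => ih _ hy y (hy.trans hx) rfl
  ext z
  constructor
  · intro hz
    have := ((H.mem_map_vonNeumann hbo).1 (H.map_sub hsub hz)).2
    rw [H.fix _ hbo hb, Ordinal.rank_toZFSet] at this
    rw [← ih' z this] at hz
    exact H.mem_iff.1 hz
  · intro hz
    rw [← ih' z (rank_lt_of_mem hz)]
    exact H.mem_iff.2 hz

theorem not_covers {β : ZFSet} (hβ : β ∈ κ) : ¬ Covers (V_ (rank β)) κ := by
  rintro ⟨f, hf⟩
  have hβo : IsOrd β := isOrd_iff.2 (H.ord.isOrdinal.mem hβ)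
  obtain ⟨x, hx, hp⟩ := H.map_graph_surj hf H.mem
  have hxr := ((H.mem_map_vonNeumann hβo).1 hx).2
  rw [H.fix β hβo hβ] at hxr
  rw [← H.map_eq_of_rank_lt x (hxr.trans (rank_lt_of_mem hβ))] at hp
  have hκf := H.eq_of_pair_mem_map_graph (mem_vonNeumann.2 hxr) hp
  have hmem : f x ∈ κ := by
    rw [← H.mem_iff, ← hκf]
    exact H.mem
  rw [H.map_eq_of_rank_lt _ (rank_lt_of_mem hmem)] at hκf
  exact mem_irrefl κ (by rwa [← hκf] at hmem)

theorem covers_vonNeumann : Covers κ (V_ (rank κ)) := by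
  have hinf : ℵ₀ ≤ #κ := by
    rw [Cardinal.aleph0_le_mk_iff, ← not_finite_iff_infinite]
    intro hfin
    obtain ⟨z, hz⟩ := H.nonempty
    have : Nonempty κ := ⟨⟨z, hz⟩⟩
    obtain ⟨⟨a, ha⟩, hmax⟩ := Finite.exists_max fun x : κ => rank (x : ZFSet)
    obtain ⟨γ, hγ, h⟩ := H.exists_mem_of_mem ha
    exact (rank_lt_of_mem h).not_ge (hmax ⟨γ, hγ⟩)
  have hcov : ∀ β ∈ κ, Covers κ (V_ (rank β)) := fun β hβ => by
    rcases le_total #κ #↥(V_ (rank β) : ZFSet) with h | h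
    · exact (H.not_covers hβ (.of_le h)).elim
    · exact .of_le h
  choose! g hg using hcov
  refine .of_le ?_
  have hsurj : ∀ y : ↥(V_ (rank κ) : ZFSet),
      ∃ p : κ × κ, g p.1 p.2 = y := by
    rintro ⟨y, hy⟩
    have hy : rank y < rank κ := mem_vonNeumann.1 hy
    obtain ⟨γ, hγ, hlt⟩ := H.exists_mem_of_mem (H.toZFSet_mem hy)
    have : y ∈ V_ (rank γ) := by
      rw [mem_vonNeumann]
      simpa using rank_lt_of_mem hlt
    obtain ⟨x, hx, h⟩ := hg γ hγ y this
    exact ⟨(⟨γ, hγ⟩, ⟨x, hx⟩), h⟩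
  choose p hp using hsurj
  have hinj : Function.Injective p := fun y z h => by
    rw [Subtype.ext_iff, ← hp, ← hp, h]
  calc _ ≤ #(κ × κ) := Cardinal.mk_le_of_injective hinj
    _ = #κ := by rw [Cardinal.mk_prod, Cardinal.lift_id, Cardinal.mul_eq_self hinf]

theorem covers_map_vonNeumann : Covers (j κ) (j (V_ (rank κ))) := by
  obtain ⟨g, hg⟩ := H.covers_vonNeumann
  classical
  refine ⟨fun x => if h : ∃ y, pair x y ∈ j (graph g κ) then h.choose else ∅, fun y hy => ?_⟩
  obtain ⟨x, hx, hp⟩ := H.map_graph_surj hg hy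
  have h : ∃ y, pair x y ∈ j (graph g κ) := ⟨y, hp⟩
  refine ⟨x, hx, ?_⟩
  beta_reduce
  rw [dif_pos h]
  exact H.map_graph_unique g κ h.choose_spec hp

theorem map_empty : j ∅ = ∅ := by
  refine H.map_eq_of_rank_lt _ ?_
  obtain ⟨x, hx⟩ := H.nonempty
  rw [rank_empty]
  exact zero_le.trans_lt (rank_lt_of_mem hx)

/-- `N` contains every subset of size at most `j κ`. -/
theorem mem_of_covers {a : ZFSet} (ha : ∀ x ∈ a, x ∈ N) (hc : Covers (j κ) a) : a ∈ N := by
  by_cases hne : a.Nonempty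
  · obtain ⟨z, hz⟩ := hne
    obtain ⟨f, hf⟩ := hc
    classical
    have hmem : ∀ x, (if f x ∈ a then f x else z) ∈ a := fun x => by
      split_ifs with h <;> assumption
    obtain ⟨F, hF, hFmem⟩ := H.closed (fun x => if f x ∈ a then f x else z)
      fun x _ => ha _ (hmem x)
    obtain ⟨R, hR, h⟩ := H.exists_range hF
    have : a = R := by
      ext y
      constructor
      · intro hy
        obtain ⟨x, hx, rfl⟩ := hf y hy
        rw [h _ (ha _ hy)]
        refine ⟨x, H.trans _ (H.map_mem κ) _ hx, (hFmem _).2 ⟨x, hx, ?_⟩⟩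
        rw [if_pos hy]
      · intro hy
        obtain ⟨x, -, hx⟩ := (h y (H.trans _ hR _ hy)).1 hy
        obtain ⟨x', -, hp⟩ := (hFmem _).1 hx
        rw [(pair_inj.1 hp).2]
        exact hmem x'
    rwa [this]
  · have : a = ∅ := by
      rw [eq_empty]
      exact fun y hy => hne ⟨y, hy⟩
    rw [this, ← H.map_empty]
    exact H.map_mem ∅

theorem mem_of_rank_lt (x : ZFSet) (hx : rank x < rank (j κ)) : x ∈ N := by
  induction x using ZFSet.inductionOn with
  | _ x ih =>
  have hN : ∀ y ∈ x, y ∈ N := fun y hy => ih y hy ((rank_lt_of_mem hy).trans hx)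
  refine H.mem_of_covers hN ?_
  obtain ⟨f, hf⟩ := H.covers_map_vonNeumann
  exact ⟨f, fun y hy => hf y ((H.mem_map_vonNeumann H.ord).2
    ⟨hN y hy, (rank_lt_of_mem hy).trans hx⟩)⟩

theorem covers_vonNeumann_map : Covers (j κ) (V_ (rank (j κ))) := by
  obtain ⟨f, hf⟩ := H.covers_map_vonNeumann
  refine ⟨f, fun y hy => hf y ((H.mem_map_vonNeumann H.ord).2 ?_)⟩
  rw [mem_vonNeumann] at hy
  exact ⟨H.mem_of_rank_lt y hy, hy⟩

theorem imageSet_mem : imageSet j (V_ (rank (j κ))) ∈ N := by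
  obtain ⟨f, hf⟩ := H.covers_vonNeumann_map
  refine H.mem_of_covers (fun y hy => ?_) ⟨j ∘ f, fun y hy => ?_⟩
  · obtain ⟨x, -, rfl⟩ := mem_imageSet.1 hy
    exact H.map_mem x
  · obtain ⟨z, hz, rfl⟩ := mem_imageSet.1 hy
    obtain ⟨x, hx, rfl⟩ := hf z hz
    exact ⟨x, hx, rfl⟩

end Rank

end HugeEmbedding

section Skolem

open ZFSet

/-- An injective numbering of formulas. -/
def SF.encode : ∀ {n}, SF n → ℕ
  | _, .mem i j => Nat.pair 0 (Nat.pair i j)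
  | _, .eq i j => Nat.pair 1 (Nat.pair i j)
  | _, .imp f g => Nat.pair 2 (Nat.pair f.encode g.encode)
  | _, .not f => Nat.pair 3 f.encode
  | _, .ex f => Nat.pair 4 f.encode

theorem SF.encode_injective {n : ℕ} : Function.Injective (SF.encode (n := n)) := by
  intro f
  induction f with
  | mem i j => intro g h; cases g <;> simp_all [SF.encode, Nat.pair_eq_pair, Fin.ext_iff]
  | eq i j => intro g h; cases g <;> simp_all [SF.encode, Nat.pair_eq_pair, Fin.ext_iff]
  | imp f₁ f₂ ih₁ ih₂ =>
    intro g h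
    cases g <;> simp [SF.encode, Nat.pair_eq_pair] at h ⊢
    exact ⟨ih₁ h.1, ih₂ h.2⟩
  | not f ih =>
    intro g h
    cases g <;> simp [SF.encode, Nat.pair_eq_pair] at h ⊢
    exact ih h
  | ex f ih =>
    intro g h
    cases g <;> simp [SF.encode, Nat.pair_eq_pair] at h ⊢
    exact ih h

/-- Lists of sets coded by iterated ordered pairs. -/
def codeList (l : List ZFSet.{u}) : ZFSet.{u} := l.foldr pair ∅

theorem pair_ne_empty (x y : ZFSet.{u}) : pair x y ≠ ∅ := fun h =>
  notMem_empty {x} (h ▸ by simp [pair])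

theorem codeList_injective : Function.Injective codeList.{u} := by
  intro l
  induction l with
  | nil =>
    rintro (_ | ⟨b, m⟩) h
    · rfl
    · exact (pair_ne_empty _ _ h.symm).elim
  | cons a l ih =>
    rintro (_ | ⟨b, m⟩) h
    · exact (pair_ne_empty _ _ h).elim
    · obtain ⟨rfl, (h' : codeList l = codeList m)⟩ := pair_inj.1 h
      rw [ih h']

theorem codeList_mem {M : Set ZFSet.{u}} (h₀ : ∅ ∈ M) (hp : ∀ x ∈ M, ∀ y ∈ M, pair x y ∈ M)
    {l : List ZFSet} (hl : ∀ x ∈ l, x ∈ M) : codeList l ∈ M := by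
  induction l with
  | nil => exact h₀
  | cons a l ih =>
    exact hp _ (hl a (by simp)) _ (ih fun x hx => hl x (by simp [hx]))

/-- A set coding a formula together with an assignment. -/
def code {n : ℕ} (φ : SF (n + 1)) (v : Fin n → ZFSet.{u}) : ZFSet.{u} :=
  pair (codeList (List.replicate φ.encode ∅)) (codeList (List.ofFn v))

theorem code_mem {M : Set ZFSet.{u}} (h₀ : ∅ ∈ M) (hp : ∀ x ∈ M, ∀ y ∈ M, pair x y ∈ M)
    {n : ℕ} (φ : SF (n + 1)) {v : Fin n → ZFSet} (hv : ∀ i, v i ∈ M) : code φ v ∈ M := by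
  refine hp _ (codeList_mem h₀ hp fun x hx => ?_) _ (codeList_mem h₀ hp fun x hx => ?_)
  · rwa [List.eq_of_mem_replicate hx]
  · obtain ⟨i, rfl⟩ := (List.mem_ofFn' _ _).1 hx
    exact hv i

/-- `y` is a witness in `U` for the existential statement coded by `c`. -/
def IsWitness (U : Set ZFSet.{u}) (c y : ZFSet.{u}) : Prop :=
  y ∈ U ∧ ∃ (n : ℕ) (φ : SF (n + 1)) (v : Fin n → ZFSet), code φ v = c ∧
    Realize U φ (Fin.cons y v)

theorem IsWitness.realize {U : Set ZFSet.{u}} {n : ℕ} {φ : SF (n + 1)} {v : Fin n → ZFSet}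
    {y : ZFSet} (h : IsWitness U (code φ v) y) : Realize U φ (Fin.cons y v) := by
  obtain ⟨-, m, ψ, w, hc, hr⟩ := h
  obtain ⟨h₁, h₂⟩ := pair_inj.1 hc
  have h₂ := codeList_injective h₂
  obtain rfl : m = n := by simpa using congrArg List.length h₂
  obtain rfl := List.ofFn_injective h₂
  have h₁ := congrArg List.length (codeList_injective h₁)
  simp only [List.length_replicate] at h₁
  obtain rfl := SF.encode_injective h₁
  exact hr

open Classical in
/-- A universal Skolem function for `U`, operating on codes. -/
noncomputable def skolem (U : Set ZFSet.{u}) (c : ZFSet.{u}) : ZFSet.{u} :=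
  if h : ∃ y, IsWitness U c y then h.choose else ∅

theorem skolem_mem {U : Set ZFSet.{u}} (h₀ : ∅ ∈ U) (c : ZFSet) : skolem U c ∈ U := by
  unfold skolem
  split_ifs with h
  · exact h.choose_spec.1
  · exact h₀

theorem prec_of_skolem {M U : Set ZFSet.{u}} (hMU : M ⊆ U) (h₀ : ∅ ∈ M)
    (hp : ∀ x ∈ M, ∀ y ∈ M, pair x y ∈ M) (hs : ∀ x ∈ M, skolem U x ∈ M) : Prec M U := by
  refine ⟨hMU, fun φ => ?_⟩
  induction φ with
  | mem i j => exact fun v _ => Iff.rfl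
  | eq i j => exact fun v _ => Iff.rfl
  | imp f g ihf ihg => exact fun v hv => imp_congr (ihf v hv) (ihg v hv)
  | not f ih => exact fun v hv => not_congr (ih v hv)
  | ex f ih =>
    intro v hv
    have hcons : ∀ x ∈ M, ∀ i, (Fin.cons x v : Fin _ → ZFSet) i ∈ M := fun x hx i => by
      induction i using Fin.cases with
      | zero => exact hx
      | succ i => exact hv i
    constructor
    · rintro ⟨x, hx, h⟩
      exact ⟨x, hMU hx, (ih _ (hcons x hx)).1 h⟩
    · rintro ⟨x, hx, h⟩
      have hc := hs _ (code_mem h₀ hp f hv)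
      have hw : ∃ y, IsWitness U (code f v) y := ⟨x, hx, _, f, v, rfl, h⟩
      have hy : IsWitness U (code f v) (skolem U (code f v)) := by
        rw [skolem, dif_pos hw]
        exact hw.choose_spec
      exact ⟨_, hc, (ih _ (hcons _ hc)).2 hy.realize⟩

end Skolem

/-- Relativized to the class `S`: the set `M` is a subset of `U` containing `o`, closed under
pairing and under the function `h`, guessing all subsets of its members, with first missing ordinal
below `κ ∈ M`, and `F` is an increasing map from `κ` into `M ∩ δ`. -/
structure Reflected (S : Set ZFSet.{u}) (F M κ δ U h o : ZFSet.{u}) : Prop where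
  sub : ∀ z ∈ S, z ∈ M → z ∈ U
  zero : o ∈ M
  crit : κ ∈ M
  missing : ∃ β ∈ S, β ∈ κ ∧ β ∉ M
  below : ∀ α ∈ S, α ∈ M → α ∈ κ → ∀ z ∈ S, z ∈ α → z ∈ M
  pairing : ∀ x ∈ S, x ∈ M → ∀ y ∈ S, y ∈ M → ∀ p ∈ S, p = ZFSet.pair x y → p ∈ M
  skolem : ∀ x ∈ S, x ∈ M → ∀ y ∈ S, ZFSet.pair x y ∈ h → y ∈ M
  guess : ∀ X ∈ S, X ∈ M → ∀ d ∈ S, (∀ z ∈ S, z ∈ d → z ∈ X) →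
    ∃ e ∈ S, e ∈ M ∧ (∀ z ∈ S, z ∈ e → z ∈ X) ∧ ∀ z ∈ S, z ∈ M → (z ∈ e ↔ z ∈ d)
  total : ∀ x ∈ S, x ∈ κ → ∃ y ∈ S, y ∈ M ∧ y ∈ δ ∧ ZFSet.pair x y ∈ F
  increasing : ∀ x ∈ S, x ∈ κ → ∀ x' ∈ S, x' ∈ κ → ∀ y ∈ S, ∀ y' ∈ S,
    ZFSet.pair x y ∈ F → ZFSet.pair x' y' ∈ F → x ∈ x' → y ∈ y'

/-- The formula expressing `Reflected`. -/
def reflectedFormula : SF 7 :=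
  .and (.sub 1 4) <| .and (.mem 6 1) <| .and (.mem 2 1) <|
  .and (.ex (.and (.mem 0 3) (.not (.mem 0 2)))) <|
  .and (.all (.imp (.mem 0 2) (.imp (.mem 0 3) (.sub 0 2)))) <|
  .and (.all (.imp (.mem 0 2) (.all (.imp (.mem 0 3) (.all (.imp (.opair 0 2 1) (.mem 0 4))))))) <|
  .and (.all (.imp (.mem 0 2) (.all (.imp (.app 7 1 0) (.mem 0 3))))) <|
  .and (.all (.imp (.mem 0 2) (.all (.imp (.sub 0 1) (.ex (.and (.mem 0 4) (.and (.sub 0 2)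
    (.all (.imp (.mem 0 5) (.iff (.mem 0 1) (.mem 0 2))))))))))) <|
  .and (.all (.imp (.mem 0 3) (.ex (.and (.mem 0 3) (.and (.mem 0 5) (.app 2 1 0)))))) <|
  .all (.imp (.mem 0 3) (.all (.imp (.mem 0 4) (.all (.all (.imp (.app 4 3 1)
    (.imp (.app 4 2 0) (.imp (.mem 3 2) (.mem 1 0)))))))))

theorem realize_reflectedFormula {S : Set ZFSet.{u}} (hS : ClassTransitive S)
    {F M κ δ U h o : ZFSet.{u}} (hF : F ∈ S) (hh : h ∈ S) :
    Realize S reflectedFormula ![F, M, κ, δ, U, h, o] ↔ Reflected S F M κ δ U h o := by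
  have happ : ∀ {n} (v : Fin n → ZFSet) (i k l : Fin n), v i = F ∨ v i = h →
      (Realize S (.app i k l) v ↔ ZFSet.pair (v k) (v l) ∈ v i) := fun v i k l hi =>
    realize_app hS (by rcases hi with hi | hi <;> rwa [hi])
  have hpair : ∀ {n} (v : Fin n → ZFSet) (k l : Fin (n + 1)), ∀ p ∈ S,
      (Realize S (.opair 0 k l) (Matrix.vecCons p v) ↔
        p = ZFSet.pair (Matrix.vecCons p v k) (Matrix.vecCons p v l)) := fun v k l p hp =>
    realize_opair hS (v := Matrix.vecCons p v) (p := 0) hp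
  have hpair' : (∀ x ∈ S, x ∈ M → ∀ y ∈ S, y ∈ M → ∀ p ∈ S,
      Realize S (.opair 0 2 1) ![p, y, x, F, M, κ, δ, U, h, o] → p ∈ M) ↔
      ∀ x ∈ S, x ∈ M → ∀ y ∈ S, y ∈ M → ∀ p ∈ S, p = ZFSet.pair x y → p ∈ M :=
    forall₂_congr fun x _ => forall_congr' fun _ => forall₂_congr fun y _ =>
      forall_congr' fun _ => forall₂_congr fun p hp => imp_congr_left (hpair _ _ _ p hp)
  simp only [reflectedFormula, realize_and, realize_all, realize_imp, realize_ex, realize_sub,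
    realize_not, realize_iff, realize_mem]
  refine Iff.trans (b := _ ∧ _ ∧ _ ∧ _ ∧ _ ∧ _ ∧ _ ∧ _ ∧ _ ∧ _) ?_
    ⟨fun ⟨a₁, a₂, a₃, a₄, a₅, a₆, a₇, a₈, a₉, a₁₀⟩ => ⟨a₁, a₂, a₃, a₄, a₅, a₆, a₇, a₈, a₉, a₁₀⟩,
      fun ⟨a₁, a₂, a₃, a₄, a₅, a₆, a₇, a₈, a₉, a₁₀⟩ => ⟨a₁, a₂, a₃, a₄, a₅, a₆, a₇, a₈, a₉, a₁₀⟩⟩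
  refine and_congr Iff.rfl <| and_congr Iff.rfl <| and_congr Iff.rfl <| and_congr Iff.rfl <|
    and_congr Iff.rfl <| and_congr hpair' <| and_congr ?_ <| and_congr Iff.rfl <|
    and_congr ?_ ?_
  · exact forall₂_congr fun x _ => forall_congr' fun _ => forall₂_congr fun y _ =>
      imp_congr_left (happ _ _ _ _ (.inr rfl))
  · exact forall₂_congr fun x _ => forall_congr' fun _ => exists_congr fun y =>
      and_congr_right fun _ => and_congr_right fun _ => and_congr_right fun _ =>
        happ _ _ _ _ (.inl rfl)
  · exact forall₂_congr fun x _ => forall_congr' fun _ => forall₂_congr fun x' _ =>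
      forall_congr' fun _ => forall₂_congr fun y _ => forall₂_congr fun y' _ =>
        imp_congr (happ _ _ _ _ (.inl rfl)) (imp_congr_left (happ _ _ _ _ (.inl rfl)))

namespace HugeEmbedding

open ZFSet
open scoped Ordinal

variable {κ : ZFSet.{u}} {N : Set ZFSet.{u}} {j : ZFSet.{u} → ZFSet.{u}}
  (H : HugeEmbedding κ N j)
include H

theorem succ_lt_rank {o : Ordinal.{u}} (ho : o < rank (j κ)) : Order.succ o < rank (j κ) := by
  have hmem : o.toZFSet ∈ j κ := by
    rw [← H.ord_map.isOrdinal.toZFSet_rank_eq]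
    simpa using ho
  obtain ⟨γ, hγ, h⟩ := H.exists_mem_of_mem_map hmem
  have := rank_lt_of_mem h
  rw [Ordinal.rank_toZFSet] at this
  exact (Order.succ_le_of_lt this).trans_lt (rank_lt_of_mem hγ)

theorem rank_pair_lt {x y : ZFSet} (hx : rank x < rank (j κ)) (hy : rank y < rank (j κ)) :
    rank (pair x y) < rank (j κ) := by
  simp only [pair, rank_pair, rank_singleton, max_lt_iff]
  exact ⟨H.succ_lt_rank (H.succ_lt_rank hx), H.succ_lt_rank
    (max_lt (H.succ_lt_rank hx) (H.succ_lt_rank hy))⟩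

end HugeEmbedding
namespace HugeEmbedding

open ZFSet
open scoped Ordinal

variable {κ : ZFSet.{u}} {N : Set ZFSet.{u}} {j : ZFSet.{u} → ZFSet.{u}}
  (H : HugeEmbedding κ N j)
include H

theorem ne_map (x : ZFSet) : κ ≠ j x := by
  intro heq
  have hx : x.IsOrdinal := (H.ord_iff.1 (heq ▸ H.ord)).isOrdinal
  rcases hx.mem_trichotomous H.ord.isOrdinal with h | h | h
  · have := H.fix x (isOrd_iff.2 hx) h
    rw [← heq] at this
    exact mem_irrefl x (this ▸ h)
  · subst h
    have := H.mem
    rw [← heq] at this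
    exact mem_irrefl x this
  · have := H.mem_iff.2 h
    rw [← heq] at this
    exact mem_asymm this H.mem

theorem reflected_image {F : ZFSet}
    (hF : ∀ p : ZFSet, p ∈ F ↔ ∃ x, x ∈ j κ ∧ p = pair x (j x)) :
    Reflected N F (imageSet j (V_ (rank (j κ)))) (j κ) (j (j κ)) (j (V_ (rank (j κ))))
      (j (graph (skolem {x | x ∈ V_ (rank (j κ))}) (V_ (rank (j κ))))) (j ∅) := by
  have hU : ∀ {x}, x ∈ V_ (rank (j κ)) ↔ rank x < rank (j κ) := mem_vonNeumann
  have hpos : rank ∅ < rank (j κ) := by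
    rw [rank_empty]
    exact zero_le.trans_lt (rank_lt_of_mem H.mem)
  have hFp : ∀ {x y}, pair x y ∈ F ↔ x ∈ j κ ∧ y = j x := fun {x y} => by
    simp only [hF, pair_inj]
    constructor
    · rintro ⟨_, h, rfl, rfl⟩
      exact ⟨h, rfl⟩
    · rintro ⟨h, rfl⟩
      exact ⟨x, h, rfl, rfl⟩
  constructor <;> try simp only [mem_imageSet]
  · rintro z - ⟨x, hx, rfl⟩
    exact H.mem_iff.2 hx
  · exact ⟨∅, hU.2 hpos, rfl⟩
  · exact ⟨κ, hU.2 (rank_lt_of_mem H.mem), rfl⟩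
  · exact ⟨κ, H.trans _ (H.map_mem κ) _ H.mem, H.mem, fun ⟨x, _, h⟩ => H.ne_map x h.symm⟩
  · rintro α - ⟨a, -, rfl⟩ haκ z - hz
    have haκ := H.mem_iff.1 haκ
    have ha : rank a < rank κ := rank_lt_of_mem haκ
    rw [H.map_eq_of_rank_lt a ha] at hz
    have hzr := (rank_lt_of_mem hz).trans ha
    exact ⟨z, hU.2 (hzr.trans (rank_lt_of_mem H.mem)), H.map_eq_of_rank_lt z hzr⟩
  · rintro _ - ⟨x, hx, rfl⟩ _ - ⟨y, hy, rfl⟩ _ - rfl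
    exact ⟨pair x y, hU.2 (H.rank_pair_lt (hU.1 hx) (hU.1 hy)), H.map_pair x y⟩
  · rintro _ - ⟨x, hx, rfl⟩ y - hy
    exact ⟨_, skolem_mem (hU.2 hpos) x, (H.eq_of_pair_mem_map_graph hx hy).symm⟩
  · rintro _ - ⟨x, hx, rfl⟩ d hd hdx
    have hsub : x.sep (fun y => j y ∈ d) ⊆ x := sep_subset
    refine ⟨j (x.sep fun y => j y ∈ d), H.map_mem _,
      ⟨_, hU.2 ((rank_mono hsub).trans_lt (hU.1 hx)), rfl⟩,
      fun z _ hz => H.map_sub hsub hz, ?_⟩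
    rintro _ - ⟨y, -, rfl⟩
    rw [H.mem_iff, mem_sep]
    exact ⟨And.right, fun h => ⟨H.mem_iff.1 (hdx _ (H.map_mem y) h), h⟩⟩
  · intro x _ hx
    exact ⟨j x, H.map_mem x, ⟨x, hU.2 (rank_lt_of_mem hx), rfl⟩, H.mem_iff.2 hx, hFp.2 ⟨hx, rfl⟩⟩
  · intro x _ _ x' _ _ y _ y' _ h h' hxx'
    rw [(hFp.1 h).2, (hFp.1 h').2]
    exact H.mem_iff.2 hxx'

theorem exists_reflected : ∃ F M : ZFSet,
    Reflected Set.univ F M κ (j κ) (V_ (rank (j κ)))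
      (graph (skolem {x | x ∈ V_ (rank (j κ))}) (V_ (rank (j κ)))) ∅ := by
  obtain ⟨F, hFN, hF⟩ := H.closed j fun x _ => H.map_mem x
  have := (H.transfer (.ex (.ex reflectedFormula)) ![κ, j κ, V_ (rank (j κ)),
    graph (skolem {x | x ∈ V_ (rank (j κ))}) (V_ (rank (j κ))), ∅]).2 (by
      refine ⟨_, H.imageSet_mem, F, hFN, ?_⟩
      have := (realize_reflectedFormula H.trans hFN (H.map_mem _)).2 (H.reflected_image hF)
      convert this using 1
      funext i
      fin_cases i <;> rfl)
  obtain ⟨M, -, F, -, h⟩ := this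
  exact ⟨F, M, (realize_reflectedFormula classTransitive_univ trivial trivial).1 h⟩

end HugeEmbedding

theorem Reflected.kappaSpec {F M κ δ U h o : ZFSet.{u}} (hR : Reflected Set.univ F M κ δ U h o)
    (hκ : IsOrd κ) : KappaSpec {x | x ∈ M} κ := by
  obtain ⟨β, -, hβ, hβM⟩ := hR.missing
  refine ⟨hκ, hR.crit, ⟨β, hβ, hβM⟩, fun α hα hαM ⟨γ, hγ, hγM⟩ => ?_⟩
  rcases hκ.isOrdinal.mem_trichotomous hα.isOrdinal with h | h | h
  · exact .inl h
  · exact .inr h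
  · exact (hγM (hR.below α trivial hαM h γ trivial hγ)).elim

theorem Reflected.guessingModel {F M κ δ U h o : ZFSet.{0}}
    (hR : Reflected Set.univ F M κ δ U h o) (μ : Cardinal) : GuessingModel {x | x ∈ M} μ := by
  intro X hX d hd _
  obtain ⟨e, -, heM, heX, he⟩ := hR.guess X trivial hX d trivial fun z _ hz => hd hz
  exact ⟨e, heM, fun z hz => heX z trivial hz, fun z hz => he z trivial hz⟩

theorem Reflected.otpGe {F M κ δ U h o : ZFSet.{u}} (hR : Reflected Set.univ F M κ δ U h o) :
    OtpGe {x | x ∈ {x | x ∈ M} ∧ x ∈ δ} κ := by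
  have := fun x hx => hR.total x trivial hx
  choose! f hf using this
  exact ⟨f, fun x hx => ⟨(hf x hx).2.1, (hf x hx).2.2.1⟩, fun x hx y hy hxy =>
    hR.increasing x trivial hx y trivial hy _ trivial _ trivial (hf x hx).2.2.2 (hf y hy).2.2.2 hxy⟩

theorem Reflected.prec {F M κ δ U : ZFSet.{u}}
    (hR : Reflected Set.univ F M κ δ U (graph (GuessingModels.skolem {x | x ∈ U}) U) ∅) :
    Prec {x | x ∈ M} {x | x ∈ U} :=
  prec_of_skolem (fun x hx => hR.sub x trivial hx) hR.zero
    (fun x hx y hy => hR.pairing x trivial hx y trivial hy _ trivial rfl)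
    fun x hx => hR.skolem x trivial hx _ trivial (pair_mem_graph.2 ⟨hR.sub x trivial hx, rfl⟩)

theorem vSet_eq (α : ZFSet.{u}) : VSet α = {x | x ∈ ZFSet.vonNeumann α.rank} := by
  ext x
  exact ZFSet.mem_vonNeumann.symm

/-- Lemma 3.7(1): if `κ` is huge then there are `λ > κ` and an `ℵ₀`-guessing model
`M ≺ V_λ` with `κ_M = κ` and `otp(M ∩ λ) ≥ κ`. -/
theorem huge_guessing (κ : ZFSet) (hκ : IsHuge κ) :
    ∃ lam : ZFSet, IsOrd lam ∧ κ ∈ lam ∧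
      ∃ M : Set ZFSet, Prec M (VSet lam) ∧ GuessingModel M ℵ₀ ∧ KappaSpec M κ ∧
        OtpGe {x | x ∈ M ∧ x ∈ lam} κ := by
  obtain ⟨hord, N, j, htrans, helem, hfix, hmem, hordj, hclosed⟩ := hκ
  obtain ⟨F, M, hR⟩ :=
    HugeEmbedding.exists_reflected ⟨hord, htrans, helem, hfix, hmem, hordj, hclosed⟩
  exact ⟨j κ, hordj, hmem, {x | x ∈ M}, vSet_eq _ ▸ hR.prec, hR.guessingModel _,
    hR.kappaSpec hord, hR.otpGe⟩

end GuessingModels
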